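/- Let φ(t) = (2/3)t^{3/2}, let β ∈ C_c^∞(ℝ) with support contained in [1/4, 2], and let a : [0,∞)×(0,∞) → ℂ be smooth in ρ with |∂_ρ^k a(t,ρ)| ≤ C_k (1+φ(t)ρ)^{−1/6} ρ^{−k} for all k ≥ 0. Set α(t,ρ) = ρ β(ρ) a(t,ρ) and α̂_t(ξ) = ∫₀^∞ e^{−iρξ} α(t,ρ) dρ. Then for every δ > 0 there exists a constant C_δ > 0, independent of t ≥ 0 and r ≥ 0, such that ∫_{−∞}^{∞} ( ∫₀^{2π} (1+φ(t))^{1/6} (1+|φ(t)−s|)^{1/2−δ} |α̂_t(φ(t) − s − r cosθ)| dθ )² ds ≤ C_δ. -/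

import Mathlib

open MeasureTheory Set
open scoped ENNReal

/-- `φ(t) = (2/3) t^{3/2}`, the characteristic function of the Tricomi operator. -/
noncomputable def phi (t : ℝ) : ℝ := (2 / 3) * t ^ ((3 : ℝ) / 2)

/-- The localized amplitude `α(t,ρ) = ρ β(ρ) a(t,ρ)`. -/
noncomputable def alphaAmp (β : ℝ → ℝ) (a : ℝ → ℝ → ℂ) (t ρ : ℝ) : ℂ :=
  ((ρ * β ρ : ℝ) : ℂ) * a t ρ

/-- The one-dimensional Fourier transform `α̂_t(ξ) = ∫₀^∞ e^{-iρξ} α(t,ρ) dρ` of the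
localized amplitude in the frequency-modulus variable `ρ`. -/
noncomputable def alphaHat (β : ℝ → ℝ) (a : ℝ → ℝ → ℂ) (t ξ : ℝ) : ℂ :=
  ∫ ρ in Ioi (0 : ℝ), Complex.exp (-(Complex.I * ρ * ξ)) * alphaAmp β a t ρ

lemma arc_bound (f f' : ℝ → ℝ) (hf : ∀ x, HasDerivAt f (f' x) x) (hc : Continuous f')
    (a b : ℝ) (hab : a ≤ b) (hs : ∀ x ∈ Icc a b, 0 ≤ f' x) :
    ∫ x in a..b, |f' x| / (1 + f x ^ 2) ≤ Real.pi := by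
  have hcf : Continuous f := continuous_iff_continuousAt.2 fun x => (hf x).continuousAt
  have h1 : ∫ x in a..b, |f' x| / (1 + f x ^ 2) = Real.arctan (f b) - Real.arctan (f a) := by
    have : ∫ x in a..b, |f' x| / (1 + f x ^ 2) = ∫ x in a..b, 1 / (1 + f x ^ 2) * f' x := by
      apply intervalIntegral.integral_congr
      intro x hx
      rw [uIcc_of_le hab] at hx
      simp only
      rw [abs_of_nonneg (hs x hx)]; ring
    rw [this]
    apply intervalIntegral.integral_eq_sub_of_hasDerivAt
    · intro x _; exact (hf x).arctan
    · apply Continuous.intervalIntegrable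
      have : ∀ x, 1 + f x ^ 2 ≠ 0 := fun x => by positivity
      fun_prop (disch := assumption)
  rw [h1]
  have := Real.arctan_lt_pi_div_two (f b)
  have := Real.neg_pi_div_two_lt_arctan (f a)
  linarith

lemma arc_bound' (f f' : ℝ → ℝ) (hf : ∀ x, HasDerivAt f (f' x) x) (hc : Continuous f')
    (a b : ℝ) (hab : a ≤ b) (hs : ∀ x ∈ Icc a b, f' x ≤ 0) :
    ∫ x in a..b, |f' x| / (1 + f x ^ 2) ≤ Real.pi := by
  have := arc_bound (fun x => - f x) (fun x => - f' x) (fun x => (hf x).neg) hc.neg a b hab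
    (fun x hx => by have := hs x hx; linarith)
  simpa using this

lemma int_sin (u r : ℝ) (hr : 0 ≤ r) :
    ∫ θ in (0:ℝ)..(2 * Real.pi), |r * Real.sin θ| / (1 + (u - r * Real.cos θ) ^ 2)
      ≤ 2 * Real.pi := by
  have hd : ∀ x, HasDerivAt (fun θ => u - r * Real.cos θ) (r * Real.sin x) x := fun x => by
    simpa using ((Real.hasDerivAt_cos x).const_mul r).const_sub u
  have hc : Continuous fun x => r * Real.sin x := by fun_prop
  have hp := Real.pi_pos
  have hcc : Continuous fun θ => |r * Real.sin θ| / (1 + (u - r * Real.cos θ) ^ 2) := by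
    have : ∀ θ, 1 + (u - r * Real.cos θ) ^ 2 ≠ 0 := fun x => by positivity
    fun_prop (disch := assumption)
  rw [← intervalIntegral.integral_add_adjacent_intervals (b := Real.pi)
    (hcc.intervalIntegrable _ _) (hcc.intervalIntegrable _ _)]
  have h1 := arc_bound _ _ hd hc 0 Real.pi hp.le
    (fun x hx => mul_nonneg hr (Real.sin_nonneg_of_nonneg_of_le_pi hx.1 hx.2))
  have h2 := arc_bound' _ _ hd hc Real.pi (2 * Real.pi) (by linarith)
    (fun x hx => by
      have := Real.sin_nonneg_of_nonneg_of_le_pi (x := x - Real.pi) (by linarith [hx.1])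
        (by linarith [hx.2])
      rw [Real.sin_sub_pi] at this
      exact mul_nonpos_of_nonneg_of_nonpos hr (by linarith))
  linarith

lemma int_cos (q : ℝ) (hr : 0 ≤ q) :
    ∫ θ in (0:ℝ)..(2 * Real.pi), |q * Real.cos θ| / (1 + (q * Real.sin θ) ^ 2)
      ≤ 3 * Real.pi := by
  have hd : ∀ x, HasDerivAt (fun θ => q * Real.sin θ) (q * Real.cos x) x := fun x =>
    (Real.hasDerivAt_sin x).const_mul q
  have hc : Continuous fun x => q * Real.cos x := by fun_prop
  have hp := Real.pi_pos
  have hcc : Continuous fun θ => |q * Real.cos θ| / (1 + (q * Real.sin θ) ^ 2) := by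
    have : ∀ θ, 1 + (q * Real.sin θ) ^ 2 ≠ 0 := fun x => by positivity
    fun_prop (disch := assumption)
  rw [← intervalIntegral.integral_add_adjacent_intervals (b := Real.pi / 2)
    (hcc.intervalIntegrable _ _) (hcc.intervalIntegrable _ _),
    ← intervalIntegral.integral_add_adjacent_intervals (a := Real.pi / 2)
      (b := Real.pi + Real.pi / 2)
    (hcc.intervalIntegrable _ _) (hcc.intervalIntegrable _ _)]
  have h1 := arc_bound _ _ hd hc 0 (Real.pi / 2) (by linarith)
    (fun x hx => mul_nonneg hr (Real.cos_nonneg_of_mem_Icc ⟨by linarith [hx.1], hx.2⟩))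
  have h2 := arc_bound' _ _ hd hc (Real.pi / 2) (Real.pi + Real.pi / 2) (by linarith)
    (fun x hx => mul_nonpos_of_nonneg_of_nonpos hr
      (Real.cos_nonpos_of_pi_div_two_le_of_le hx.1 hx.2))
  have h3 := arc_bound _ _ hd hc (Real.pi + Real.pi / 2) (2 * Real.pi) (by linarith)
    (fun x hx => by
      have := Real.cos_nonneg_of_mem_Icc (x := x - 2 * Real.pi) ⟨by linarith [hx.1], by linarith [hx.2]⟩
      rw [Real.cos_sub_two_pi] at this
      exact mul_nonneg hr this)
  linarith

lemma core_alg (q s c : ℝ) (hq : 0 ≤ q) (hs : 0 ≤ s) (hc : 0 ≤ c) (hsc : s ^ 2 + c ^ 2 = 1) :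
    (1 + q) * (1 + q * s) ≤ 3 + 4 * (q ^ 2 * s) + 2 * (q * c / (1 + (q * s) ^ 2)) := by
  have hs1 : s ≤ 1 := by nlinarith
  have hc1 : c ≤ 1 := by nlinarith
  have hA : q * s ≤ 1 + q ^ 2 * s := by
    rcases le_total q 1 with h | h
    · have : q * s ≤ 1 := by nlinarith
      have : 0 ≤ q ^ 2 * s := by positivity
      linarith
    · have : q * s ≤ q ^ 2 * s := by
        apply mul_le_mul_of_nonneg_right _ hs; nlinarith
      linarith
  have hB : q * c ≤ q ^ 2 * s + 2 * (q * c / (1 + (q * s) ^ 2)) := by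
    rcases le_total (q * s) 1 with h | h
    · have h0 : 0 ≤ q * s := by positivity
      have : q * c ≤ 2 * (q * c / (1 + (q * s) ^ 2)) := by
        rw [← mul_div_assoc, le_div_iff₀ (by positivity)]
        have : (q * s) ^ 2 ≤ 1 := by nlinarith
        have : 0 ≤ q * c := by positivity
        nlinarith
      have : 0 ≤ q ^ 2 * s := by positivity
      linarith
    · have : q * c ≤ q ^ 2 * s := by nlinarith
      have : 0 ≤ q * c / (1 + (q * s) ^ 2) := by positivity
      linarith
  have hC : q ≤ q * s + q * c := by
    have : 1 ≤ s + c := by nlinarith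
    nlinarith
  nlinarith

lemma core_pt (u r θ : ℝ) (hr : 0 ≤ r) :
    √(1 + |u|) * √(1 + |(r - |u|)|) * ((1 + |u - r * Real.cos θ|) ^ 3)⁻¹ ≤
      3 + 4 * (|r * Real.sin θ| / (1 + (u - r * Real.cos θ) ^ 2))
        + 2 * (|√r * Real.cos θ| / (1 + (√r * Real.sin θ) ^ 2)) := by
  set x := u - r * Real.cos θ with hx
  set s := |Real.sin θ| with hs
  set c := |Real.cos θ| with hc
  have hs0 : 0 ≤ s := abs_nonneg _
  have hc0 : 0 ≤ c := abs_nonneg _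
  have hsc : s ^ 2 + c ^ 2 = 1 := by
    rw [hs, hc, sq_abs, sq_abs]; exact Real.sin_sq_add_cos_sq θ
  have hc1 : c ≤ 1 := by nlinarith
  have hxa : 0 ≤ |x| := abs_nonneg _
  have hrc : |r * Real.cos θ| = r * c := by rw [abs_mul, abs_of_nonneg hr]
  have h1 : 1 + |u| ≤ (1 + |x|) * (1 + r) := by
    have : |u| ≤ |x| + r * c := by
      rw [← hrc]; have := abs_add_le x (r * Real.cos θ); rwa [hx, sub_add_cancel] at this
    have : r * c ≤ r := by nlinarith
    have : 0 ≤ |x| * r := by positivity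
    nlinarith
  have h2 : 1 + |(r - |u|)| ≤ (1 + |x|) * (1 + r * s ^ 2) := by
    have h3 : |(|u| - r * c)| ≤ |x| := by
      rw [← hrc]; exact abs_abs_sub_abs_le _ _
    have h4 : |(r - |u|)| ≤ |r - r * c| + |(r * c - |u|)| := abs_sub_le _ _ _
    rw [abs_sub_comm (r * c)] at h4
    have h5 : |r - r * c| = r * (1 - c) := by
      rw [abs_of_nonneg] <;> nlinarith
    have h6 : r * (1 - c) ≤ r * s ^ 2 := by
      apply mul_le_mul_of_nonneg_left _ hr; nlinarith
    have : 0 ≤ |x| * (r * s ^ 2) := by positivity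
    nlinarith
  have hq : √r ^ 2 = r := Real.sq_sqrt hr
  have hq0 := Real.sqrt_nonneg r
  have h3 : √(1 + |u|) * √(1 + |(r - |u|)|) ≤ (1 + |x|) * ((1 + √r) * (1 + √r * s)) := by
    rw [← Real.sqrt_mul (by positivity)]
    apply Real.sqrt_le_iff.2 ⟨by positivity, ?_⟩
    calc (1 + |u|) * (1 + |(r - |u|)|) ≤ ((1 + |x|) * (1 + r)) * ((1 + |x|) * (1 + r * s ^ 2)) := by
          gcongr
      _ = (1 + |x|) ^ 2 * ((1 + √r ^ 2) * (1 + (√r * s) ^ 2)) := by rw [mul_pow, hq]; ring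
      _ ≤ (1 + |x|) ^ 2 * ((1 + √r) ^ 2 * (1 + √r * s) ^ 2) := by
          have : 0 ≤ √r * s := by positivity
          gcongr <;> nlinarith
      _ = _ := by ring
  have h4 := core_alg (√r) s c hq0 hs0 hc0 hsc
  rw [hq] at h4
  have h5 : |r * Real.sin θ| = r * s := by rw [abs_mul, abs_of_nonneg hr]
  have h6 : |√r * Real.cos θ| = √r * c := by rw [abs_mul, abs_of_nonneg hq0]
  have h7 : (√r * Real.sin θ) ^ 2 = (√r * s) ^ 2 := by rw [mul_pow, mul_pow, hs, sq_abs]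
  rw [h5, h6, h7]
  have hX : ((1 + |x|) ^ 2)⁻¹ ≤ (1 + x ^ 2)⁻¹ := by
    apply inv_anti₀ (by positivity); nlinarith [sq_abs x]
  have hX1 : ((1 + |x|) ^ 2)⁻¹ ≤ 1 := by
    apply inv_le_one_of_one_le₀; nlinarith
  set k := ((1 + |x|) ^ 2)⁻¹ with hk
  have hk0 : 0 ≤ k := by positivity
  set D := √r * c / (1 + (√r * s) ^ 2)
  have hD : 0 ≤ D := by positivity
  calc √(1 + |u|) * √(1 + |(r - |u|)|) * ((1 + |x|) ^ 3)⁻¹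
      ≤ (1 + |x|) * ((1 + √r) * (1 + √r * s)) * ((1 + |x|) ^ 3)⁻¹ := by gcongr
    _ = ((1 + √r) * (1 + √r * s)) * k := by rw [hk]; field_simp
    _ ≤ (3 + 4 * (r * s) + 2 * D) * k := by gcongr
    _ = 3 * k + 4 * (r * s * k) + 2 * (D * k) := by ring
    _ ≤ 3 * 1 + 4 * (r * s * (1 + x ^ 2)⁻¹) + 2 * (D * 1) := by gcongr
    _ = _ := by ring

lemma core_int (u r : ℝ) (hr : 0 ≤ r) (g : ℝ → ℝ) (hg : ∀ θ, 0 ≤ g θ) (B : ℝ) (hB : 0 ≤ B)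
    (hgB : ∀ θ, g θ ≤ B * ((1 + |u - r * Real.cos θ|) ^ 3)⁻¹) :
    √(1 + |u|) * √(1 + |(r - |u|)|) * (∫ θ in Ioo (0:ℝ) (2 * Real.pi), g θ) ≤ B * (20 * Real.pi) := by
  rw [← integral_const_mul]
  have hp := Real.pi_pos
  have c1 : Continuous fun θ => |r * Real.sin θ| / (1 + (u - r * Real.cos θ) ^ 2) := by
    have : ∀ θ, 1 + (u - r * Real.cos θ) ^ 2 ≠ 0 := fun x => by positivity
    fun_prop (disch := assumption)
  have c2 : Continuous fun θ => |√r * Real.cos θ| / (1 + (√r * Real.sin θ) ^ 2) := by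
    have : ∀ θ, 1 + (√r * Real.sin θ) ^ 2 ≠ 0 := fun x => by positivity
    fun_prop (disch := assumption)
  have hcont : Continuous fun θ => B * (3 + 4 * (|r * Real.sin θ| / (1 + (u - r * Real.cos θ) ^ 2))
        + 2 * (|√r * Real.cos θ| / (1 + (√r * Real.sin θ) ^ 2))) := by
    fun_prop
  calc _ ≤ ∫ θ in Ioo (0:ℝ) (2 * Real.pi),
        B * (3 + 4 * (|r * Real.sin θ| / (1 + (u - r * Real.cos θ) ^ 2))
        + 2 * (|√r * Real.cos θ| / (1 + (√r * Real.sin θ) ^ 2))) := by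
        apply integral_mono_of_nonneg
        · exact Filter.Eventually.of_forall fun θ => by have := hg θ; simp only [Pi.zero_apply]; positivity
        · exact (hcont.integrableOn_Icc (a := 0) (b := 2 * Real.pi)).mono_set Ioo_subset_Icc_self
        · refine Filter.Eventually.of_forall fun θ => ?_
          have := mul_le_mul_of_nonneg_left (core_pt u r θ hr) hB
          refine le_trans ?_ this
          have h2 := mul_le_mul_of_nonneg_left (hgB θ)
            (show 0 ≤ √(1 + |u|) * √(1 + |(r - |u|)|) by positivity)
          simp only at h2 ⊢
          linarith
    _ = ∫ θ in (0:ℝ)..(2 * Real.pi),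
        B * (3 + 4 * (|r * Real.sin θ| / (1 + (u - r * Real.cos θ) ^ 2))
        + 2 * (|√r * Real.cos θ| / (1 + (√r * Real.sin θ) ^ 2))) := by
        rw [intervalIntegral.integral_of_le (by positivity), integral_Ioc_eq_integral_Ioo]
    _ ≤ _ := by
        rw [intervalIntegral.integral_const_mul, intervalIntegral.integral_add,
          intervalIntegral.integral_add, intervalIntegral.integral_const_mul,
          intervalIntegral.integral_const_mul, intervalIntegral.integral_const]
        · apply mul_le_mul_of_nonneg_left _ hB
          have h1 := int_sin u r hr
          have h2 := int_cos (√r) (Real.sqrt_nonneg r)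
          simp only [smul_eq_mul]
          linarith
        all_goals exact Continuous.intervalIntegrable (by fun_prop) _ _

lemma amp_zero (β : ℝ → ℝ) (hβsupp : Function.support β ⊆ Icc (1 / 4 : ℝ) 2)
    (a : ℝ → ℝ → ℂ) (t ρ : ℝ) (h : ρ ∉ Icc (1 / 4 : ℝ) 2) : alphaAmp β a t ρ = 0 := by
  have : β ρ = 0 := by
    by_contra hne; exact h (hβsupp hne)
  simp [alphaAmp, this]

lemma amp_tsupp (β : ℝ → ℝ) (hβsupp : Function.support β ⊆ Icc (1 / 4 : ℝ) 2)
    (a : ℝ → ℝ → ℂ) (t : ℝ) : tsupport (alphaAmp β a t) ⊆ Icc (1 / 4 : ℝ) 2 := by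
  apply closure_minimal _ isClosed_Icc
  intro ρ hρ
  by_contra h
  exact hρ (amp_zero β hβsupp a t ρ h)

lemma amp_contDiffOn (β : ℝ → ℝ) (hβ : ContDiff ℝ (⊤ : ℕ∞) β) :
    ContDiff ℝ (⊤ : ℕ∞) (fun ρ => ((ρ * β ρ : ℝ) : ℂ)) :=
  Complex.ofRealCLM.contDiff.comp (contDiff_id.mul hβ)

lemma amp_contDiff (β : ℝ → ℝ) (hβ : ContDiff ℝ (⊤ : ℕ∞) β)
    (hβsupp : Function.support β ⊆ Icc (1 / 4 : ℝ) 2)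
    (a : ℝ → ℝ → ℂ) (t : ℝ) (h : ContDiffOn ℝ (⊤ : ℕ∞) (a t) (Ioi 0)) :
    ContDiff ℝ (⊤ : ℕ∞) (alphaAmp β a t) := by
  rw [contDiff_iff_contDiffAt]
  intro ρ
  by_cases hρ : 0 < ρ
  · exact (amp_contDiffOn β hβ).contDiffAt.mul (h.contDiffAt (Ioi_mem_nhds hρ))
  · have : ρ ∉ tsupport (alphaAmp β a t) := fun h' => by
      have := (amp_tsupp β hβsupp a t h').1
      linarith
    have h2 := notMem_tsupport_iff_eventuallyEq.1 this
    exact contDiffAt_const.congr_of_eventuallyEq h2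

lemma amp_iter_zero (β : ℝ → ℝ) (hβsupp : Function.support β ⊆ Icc (1 / 4 : ℝ) 2)
    (a : ℝ → ℝ → ℂ) (t : ℝ) (n : ℕ) (ρ : ℝ) (h : ρ ∉ Icc (1 / 4 : ℝ) 2) :
    iteratedDeriv n (alphaAmp β a t) ρ = 0 := by
  have h1 : ρ ∉ tsupport (alphaAmp β a t) := fun h' => h (amp_tsupp β hβsupp a t h')
  have h2 : ρ ∉ Function.support (iteratedFDeriv ℝ n (alphaAmp β a t)) :=
    fun h' => h1 (support_iteratedFDeriv_subset n h')
  rw [Function.notMem_support] at h2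
  simp [iteratedDeriv, h2]

lemma amp_bound (β : ℝ → ℝ) (hβ : ContDiff ℝ (⊤ : ℕ∞) β)
    (hβsupp : Function.support β ⊆ Icc (1 / 4 : ℝ) 2)
    (a : ℝ → ℝ → ℂ) (Ck : ℕ → ℝ)
    (hasm : ∀ t ∈ Ici (0 : ℝ), ContDiffOn ℝ (⊤ : ℕ∞) (a t) (Ioi 0))
    (hab : ∀ k : ℕ, ∀ t ∈ Ici (0 : ℝ), ∀ ρ ∈ Ioi (0 : ℝ),
      ‖iteratedDerivWithin k (a t) (Ioi 0) ρ‖ ≤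
        Ck k * (1 + phi t * ρ) ^ (-(1 : ℝ) / 6) * ρ ^ (-(k : ℝ))) (n : ℕ) :
    ∃ A : ℝ, 0 ≤ A ∧ ∀ t, 0 ≤ t → ∀ ρ, ‖iteratedDeriv n (alphaAmp β a t) ρ‖ ≤
      A * (1 + phi t) ^ (-(1 : ℝ) / 6) := by
  have hb := amp_contDiffOn β hβ
  set b : ℝ → ℂ := fun ρ => ((ρ * β ρ : ℝ) : ℂ) with hbdef
  have hB : ∀ i : ℕ, ∃ B : ℝ, 0 ≤ B ∧ ∀ ρ ∈ Icc (1/4:ℝ) 2, ‖iteratedFDeriv ℝ i b ρ‖ ≤ B := by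
    intro i
    obtain ⟨B, hB⟩ := (isCompact_Icc (a := (1/4:ℝ)) (b := 2)).exists_bound_of_continuousOn
      (hb.continuous_iteratedFDeriv (m := i) (by exact_mod_cast le_top)).continuousOn
    exact ⟨B, le_trans (norm_nonneg _) (hB 1 (by norm_num)), hB⟩
  choose B hB0 hB using hB
  refine ⟨∑ i ∈ Finset.range (n + 1), (n.choose i : ℝ) * B i * (|Ck (n - i)| * 4 * 4 ^ (n - i)),
    Finset.sum_nonneg fun i _ => by have := hB0 i; positivity, ?_⟩
  intro t ht ρ
  have hphi : 0 ≤ phi t := by unfold phi; positivity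
  by_cases hρ : ρ ∈ Icc (1/4:ℝ) 2
  swap
  · rw [amp_iter_zero β hβsupp a t n ρ hρ, norm_zero]
    have : ∀ i, 0 ≤ B i := hB0
    refine mul_nonneg (Finset.sum_nonneg fun i _ => ?_) (by positivity)
    have := hB0 i; positivity
  have hρ0 : 0 < ρ := by linarith [hρ.1]
  have hρm : ρ ∈ Ioi (0:ℝ) := hρ0
  rw [← iteratedDerivWithin_of_isOpen isOpen_Ioi hρm,
    ← norm_iteratedFDerivWithin_eq_norm_iteratedDerivWithin]
  refine (norm_iteratedFDerivWithin_mul_le (f := b) (g := a t) (N := (⊤ : ℕ∞)) hb.contDiffOn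
    (hasm t ht) isOpen_Ioi.uniqueDiffOn hρm (n := n) (by exact_mod_cast le_top)).trans ?_
  rw [Finset.sum_mul]
  apply Finset.sum_le_sum
  intro i _
  rw [mul_assoc (_ * _)]
  have e1 : (1 + phi t * ρ) ^ (-(1 : ℝ) / 6) ≤ 4 * (1 + phi t) ^ (-(1 : ℝ) / 6) := by
    calc (1 + phi t * ρ) ^ (-(1 : ℝ) / 6) ≤ ((1 + phi t) / 4) ^ (-(1 : ℝ) / 6) := by
          apply Real.rpow_le_rpow_of_nonpos (by positivity) _ (by norm_num)
          nlinarith [hρ.1]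
      _ = (1/4:ℝ) ^ (-(1 : ℝ) / 6) * (1 + phi t) ^ (-(1 : ℝ) / 6) := by
          rw [← Real.mul_rpow (by norm_num) (by positivity)]; congr 1; ring
      _ ≤ _ := by
          gcongr
          calc (1/4:ℝ) ^ (-(1 : ℝ) / 6) ≤ (1/4:ℝ) ^ (-1 : ℝ) :=
                Real.rpow_le_rpow_of_exponent_ge (by norm_num) (by norm_num) (by norm_num)
            _ = 4 := by rw [Real.rpow_neg_one]; norm_num
  have e2 : ρ ^ (-((n - i : ℕ) : ℝ)) ≤ 4 ^ (n - i) := by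
    rw [Real.rpow_neg hρ0.le, Real.rpow_natCast, ← inv_pow]
    gcongr
    rw [inv_le_comm₀ hρ0 (by norm_num)]; linarith [hρ.1]
  gcongr
  · exact mul_nonneg (by positivity) (hB0 i)
  · rw [iteratedFDerivWithin_of_isOpen i isOpen_Ioi hρm]; exact hB i ρ hρ
  · rw [norm_iteratedFDerivWithin_eq_norm_iteratedDerivWithin]
    refine (hab (n - i) t ht ρ hρm).trans ?_
    calc _ ≤ |Ck (n - i)| * (4 * (1 + phi t) ^ (-(1 : ℝ) / 6)) * 4 ^ (n - i) := by
          gcongr; exact le_abs_self _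
      _ = _ := by ring

lemma hat_eq (β : ℝ → ℝ) (hβsupp : Function.support β ⊆ Icc (1 / 4 : ℝ) 2)
    (a : ℝ → ℝ → ℂ) (t ξ : ℝ) :
    alphaHat β a t ξ = FourierTransform.fourier (alphaAmp β a t) (ξ / (2 * Real.pi)) := by
  rw [Real.fourier_real_eq_integral_exp_smul, alphaHat,
    setIntegral_eq_integral_of_forall_compl_eq_zero]
  · congr 1; ext ρ
    rw [smul_eq_mul]; congr 2
    push_cast
    have : (Real.pi : ℂ) ≠ 0 := by exact_mod_cast Real.pi_ne_zero
    field_simp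
  · intro ρ hρ
    rw [amp_zero β hβsupp a t ρ (fun h => hρ (by have := h.1; simp; linarith)), mul_zero]

lemma hat_iter (β : ℝ → ℝ) (hβ : ContDiff ℝ (⊤ : ℕ∞) β)
    (hβsupp : Function.support β ⊆ Icc (1 / 4 : ℝ) 2)
    (a : ℝ → ℝ → ℂ) (t : ℝ) (h : ContDiffOn ℝ (⊤ : ℕ∞) (a t) (Ioi 0)) (n : ℕ) (A : ℝ)
    (hA : ∀ ρ, ‖iteratedDeriv n (alphaAmp β a t) ρ‖ ≤ A) (ξ : ℝ) :
    |ξ| ^ n * ‖alphaHat β a t ξ‖ ≤ 2 * A := by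
  have hcd := amp_contDiff β hβ hβsupp a t h
  have hA0 : 0 ≤ A := (norm_nonneg _).trans (hA 0)
  have hint : ∀ m : ℕ, Integrable (iteratedDeriv m (alphaAmp β a t)) := by
    intro m
    apply Continuous.integrable_of_hasCompactSupport
    · exact hcd.continuous_iteratedDeriv m (by exact_mod_cast le_top)
    · exact HasCompactSupport.intro isCompact_Icc (fun ρ hρ => amp_iter_zero β hβsupp a t m ρ hρ)
  have key := congrFun (Real.fourier_iteratedDeriv (N := ⊤) (n := n) hcd (fun m _ => hint m) le_top)
    (ξ / (2 * Real.pi))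
  have h1 : ‖FourierTransform.fourier (iteratedDeriv n (alphaAmp β a t)) (ξ / (2 * Real.pi))‖
      = |ξ| ^ n * ‖alphaHat β a t ξ‖ := by
    rw [key, hat_eq β hβsupp]
    simp only [norm_smul, norm_pow]
    congr 2
    have : (2 * (Real.pi:ℂ) * Complex.I * ((ξ / (2 * Real.pi) : ℝ) : ℂ)) = ξ * Complex.I := by
      push_cast
      have : (Real.pi : ℂ) ≠ 0 := by exact_mod_cast Real.pi_ne_zero
      field_simp
    rw [this]; simp
  rw [← h1]
  refine (VectorFourier.norm_fourierIntegral_le_integral_norm _ _ _ _ _).trans ?_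
  rw [← setIntegral_eq_integral_of_forall_compl_eq_zero (s := Icc (1/4:ℝ) 2)
    (fun ρ hρ => by rw [amp_iter_zero β hβsupp a t n ρ hρ, norm_zero])]
  calc _ ≤ ∫ ρ in Icc (1/4:ℝ) 2, A := by
        apply setIntegral_mono (hint n).norm.integrableOn (by simp) hA
    _ ≤ 2 * A := by
        simp [Measure.real]
        rw [ENNReal.toReal_ofReal (by norm_num)]; nlinarith

lemma hat_bound (β : ℝ → ℝ) (hβ : ContDiff ℝ (⊤ : ℕ∞) β)
    (hβsupp : Function.support β ⊆ Icc (1 / 4 : ℝ) 2)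
    (a : ℝ → ℝ → ℂ) (Ck : ℕ → ℝ)
    (hasm : ∀ t ∈ Ici (0 : ℝ), ContDiffOn ℝ (⊤ : ℕ∞) (a t) (Ioi 0))
    (hab : ∀ k : ℕ, ∀ t ∈ Ici (0 : ℝ), ∀ ρ ∈ Ioi (0 : ℝ),
      ‖iteratedDerivWithin k (a t) (Ioi 0) ρ‖ ≤
        Ck k * (1 + phi t * ρ) ^ (-(1 : ℝ) / 6) * ρ ^ (-(k : ℝ))) :
    ∃ B : ℝ, 0 ≤ B ∧ ∀ t, 0 ≤ t → ∀ ξ, (1 + phi t) ^ ((1 : ℝ) / 6) * ‖alphaHat β a t ξ‖ ≤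
      B * ((1 + |ξ|) ^ 3)⁻¹ := by
  obtain ⟨A0, h00, h0⟩ := amp_bound β hβ hβsupp a Ck hasm hab 0
  obtain ⟨A3, h30, h3⟩ := amp_bound β hβ hβsupp a Ck hasm hab 3
  refine ⟨8 * A0 + 8 * A3, by positivity, fun t ht ξ => ?_⟩
  have hphi : 0 ≤ phi t := by unfold phi; positivity
  have i0 := hat_iter β hβ hβsupp a t (hasm t ht) 0 _ (h0 t ht) ξ
  have i3 := hat_iter β hβ hβsupp a t (hasm t ht) 3 _ (h3 t ht) ξ
  rw [pow_zero, one_mul] at i0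
  rw [← div_eq_mul_inv, le_div_iff₀ (by positivity)]
  set X := ‖alphaHat β a t ξ‖
  have hX : 0 ≤ X := norm_nonneg _
  set P := (1 + phi t) ^ ((1 : ℝ) / 6) with hP
  have hPQ : P * (1 + phi t) ^ (-(1 : ℝ) / 6) = 1 := by
    rw [hP, ← Real.rpow_add (by positivity)]; norm_num
  have hP0 : 0 ≤ P := by positivity
  have hy := abs_nonneg ξ
  set y := |ξ|
  have hy3 : (1 + y) ^ 3 ≤ 4 * (1 + y ^ 3) := by nlinarith [mul_nonneg (add_nonneg zero_le_one hy) (sq_nonneg (y - 1))]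
  calc P * X * (1 + y) ^ 3 ≤ P * X * (4 * (1 + y ^ 3)) := by gcongr
    _ = P * (4 * (X + y ^ 3 * X)) := by ring
    _ ≤ P * (4 * (2 * (A0 * (1 + phi t) ^ (-(1 : ℝ) / 6)) + 2 * (A3 * (1 + phi t) ^ (-(1 : ℝ) / 6)))) := by
        gcongr
    _ = (8 * A0 + 8 * A3) * (P * (1 + phi t) ^ (-(1 : ℝ) / 6)) := by ring
    _ = _ := by rw [hPQ, mul_one]


lemma young_pt (w v δ : ℝ) (hw : 1 ≤ w) (hv : 1 ≤ v) (hδ : 0 < δ) :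
    w ^ (-(2 * δ)) * v⁻¹ ≤ w ^ (-(1 + 2 * δ)) + v ^ (-(1 + 2 * δ)) := by
  have hw0 : 0 < w := by linarith
  have hv0 : 0 < v := by linarith
  have key : ∀ z : ℝ, 0 < z → z ^ (-(1 + 2 * δ)) = z ^ (-(2 * δ)) * z⁻¹ := fun z hz => by
    rw [← Real.rpow_neg_one z, ← Real.rpow_add hz]; congr 1; ring
  rcases le_total w v with h | h
  · have h1 : w ^ (-(2 * δ)) * v⁻¹ ≤ w ^ (-(1 + 2 * δ)) := by
      rw [key w hw0]; gcongr
    have : 0 ≤ v ^ (-(1 + 2 * δ)) := by positivity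
    linarith
  · have h1 : w ^ (-(2 * δ)) * v⁻¹ ≤ v ^ (-(1 + 2 * δ)) := by
      rw [key v hv0]
      apply mul_le_mul_of_nonneg_right _ (by positivity)
      exact Real.rpow_le_rpow_of_nonpos hv0 h (by linarith)
    have : 0 ≤ w ^ (-(1 + 2 * δ)) := by positivity
    linarith

lemma v_split (u r p : ℝ) :
    (1 + |(r - |u|)|) ^ p ≤ (1 + |r - u|) ^ p + (1 + |r + u|) ^ p := by
  have h1 : 0 ≤ (1 + |r - u|) ^ p := by positivity
  have h2 : 0 ≤ (1 + |r + u|) ^ p := by positivity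
  rcases abs_cases u with ⟨h, _⟩ | ⟨h, _⟩
  · rw [h]; linarith
  · rw [h, sub_neg_eq_add]; linarith

lemma final_sq (u r δ M J : ℝ) (hδ : 0 < δ) (hJ : 0 ≤ J)
    (h : √(1 + |u|) * √(1 + |(r - |u|)|) * J ≤ M) :
    ((1 + |u|) ^ ((1 : ℝ) / 2 - δ) * J) ^ 2 ≤ M ^ 2 * ((1 + |u|) ^ (-(1 + 2 * δ)) +
      ((1 + |r - u|) ^ (-(1 + 2 * δ)) + (1 + |r + u|) ^ (-(1 + 2 * δ)))) := by
  have hw : 1 ≤ 1 + |u| := by linarith [abs_nonneg u]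
  have hv : 1 ≤ 1 + |(r - |u|)| := by linarith [abs_nonneg (r - |u|)]
  have hY := young_pt _ _ δ hw hv hδ
  have hS := v_split u r (-(1 + 2 * δ))
  set w := 1 + |u|
  set v := 1 + |(r - |u|)|
  have hw0 : 0 < w := by linarith
  have hv0 : 0 < v := by linarith
  have h2 : (√w * √v * J) ^ 2 ≤ M ^ 2 := by
    apply pow_le_pow_left₀ (by positivity) h
  have h3 : (√w * √v * J) ^ 2 = w * v * J ^ 2 := by
    rw [mul_pow, mul_pow, Real.sq_sqrt hw0.le, Real.sq_sqrt hv0.le]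
  rw [h3] at h2
  have h4 : (w ^ ((1 : ℝ) / 2 - δ)) ^ 2 = w ^ (-(2 * δ)) * w := by
    rw [← Real.rpow_natCast, ← Real.rpow_mul hw0.le]
    nth_rewrite 3 [← Real.rpow_one w]
    rw [← Real.rpow_add hw0]; congr 1; push_cast; ring
  calc (w ^ ((1 : ℝ) / 2 - δ) * J) ^ 2 = (w ^ (-(2 * δ)) * v⁻¹) * (w * v * J ^ 2) := by
        rw [mul_pow, h4]; field_simp
    _ ≤ (w ^ (-(2 * δ)) * v⁻¹) * M ^ 2 := by gcongr
    _ ≤ (w ^ (-(1 + 2 * δ)) + v ^ (-(1 + 2 * δ))) * M ^ 2 := by gcongr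
    _ ≤ _ := by
        rw [mul_comm]; gcongr

/-- The uniform square-integral bound (the Claim): for every `δ > 0` there is `C_δ > 0`,
independent of `t ≥ 0` and `r ≥ 0`, with
`∫_{-∞}^∞ ( ∫₀^{2π} (1+φ(t))^{1/6} ⟨φ(t)-s⟩^{1/2-δ} |α̂_t(φ(t)-s-r cos θ)| dθ )² ds ≤ C_δ`. -/
theorem stmt17 (β : ℝ → ℝ) (hβ : ContDiff ℝ (⊤ : ℕ∞) β)
    (hβsupp : Function.support β ⊆ Icc (1 / 4 : ℝ) 2)
    (a : ℝ → ℝ → ℂ) (Ck : ℕ → ℝ)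
    (hasm : ∀ t ∈ Ici (0 : ℝ), ContDiffOn ℝ (⊤ : ℕ∞) (a t) (Ioi 0))
    (hab : ∀ k : ℕ, ∀ t ∈ Ici (0 : ℝ), ∀ ρ ∈ Ioi (0 : ℝ),
      ‖iteratedDerivWithin k (a t) (Ioi 0) ρ‖ ≤
        Ck k * (1 + phi t * ρ) ^ (-(1 : ℝ) / 6) * ρ ^ (-(k : ℝ)))
    (δ : ℝ) (hδ : 0 < δ) :
    ∃ C > (0 : ℝ), ∀ t : ℝ, 0 ≤ t → ∀ r : ℝ, 0 ≤ r →
      (∫⁻ s : ℝ,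
        (ENNReal.ofReal (∫ θ in Ioo (0 : ℝ) (2 * Real.pi),
          (1 + phi t) ^ ((1 : ℝ) / 6) * (1 + |phi t - s|) ^ ((1 : ℝ) / 2 - δ) *
            ‖alphaHat β a t (phi t - s - r * Real.cos θ)‖)) ^ 2)
        ≤ ENNReal.ofReal C := by
  obtain ⟨B, hB0, hB⟩ := hat_bound β hβ hβsupp a Ck hasm hab
  set M : ℝ := B * (20 * Real.pi) with hM
  set f : ℝ → ℝ := fun x => (1 + |x|) ^ (-(1 + 2 * δ)) with hf
  have hfi : Integrable f := by
    have := integrable_one_add_norm (E := ℝ) (μ := volume) (r := 1 + 2 * δ) (by simp; linarith)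
    simpa only [Real.norm_eq_abs] using this
  have hf0 : ∀ x, 0 ≤ f x := fun x => by simp only [hf]; positivity
  have hfin : ∫⁻ x, ENNReal.ofReal (f x) = ENNReal.ofReal (∫ x, f x) :=
    (ofReal_integral_eq_lintegral_ofReal hfi (Filter.Eventually.of_forall hf0)).symm
  have hfm : Measurable fun x => ENNReal.ofReal (f x) := by
    simp only [hf]; fun_prop
  have hI0 : 0 ≤ ∫ x, f x := integral_nonneg hf0
  refine ⟨M ^ 2 * (3 * ∫ x, f x) + 1, by positivity, fun t ht r hr => ?_⟩
  have hphi : 0 ≤ phi t := by unfold phi; positivity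
  calc _ ≤ ∫⁻ s : ℝ, ENNReal.ofReal (M ^ 2) * (ENNReal.ofReal (f (phi t - s)) +
        (ENNReal.ofReal (f ((r - phi t) + s)) + ENNReal.ofReal (f ((r + phi t) - s)))) := by
        apply lintegral_mono
        intro s
        simp only
        set J := ∫ θ in Ioo (0 : ℝ) (2 * Real.pi),
          (1 + phi t) ^ ((1 : ℝ) / 6) * ‖alphaHat β a t (phi t - s - r * Real.cos θ)‖ with hJ
        have hJ0 : 0 ≤ J := integral_nonneg fun θ => by simp only [Pi.zero_apply]; positivity
        have e : (∫ θ in Ioo (0 : ℝ) (2 * Real.pi),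
          (1 + phi t) ^ ((1 : ℝ) / 6) * (1 + |phi t - s|) ^ ((1 : ℝ) / 2 - δ) *
            ‖alphaHat β a t (phi t - s - r * Real.cos θ)‖) =
            (1 + |phi t - s|) ^ ((1 : ℝ) / 2 - δ) * J := by
          rw [hJ, ← integral_const_mul]; congr 1; ext θ; ring
        rw [e, ← ENNReal.ofReal_pow (by positivity), ← ENNReal.ofReal_add (hf0 _) (hf0 _),
          ← ENNReal.ofReal_add (hf0 _) (add_nonneg (hf0 _) (hf0 _)),
          ← ENNReal.ofReal_mul (by positivity)]
        apply ENNReal.ofReal_le_ofReal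
        have h1 := core_int (phi t - s) r hr _ (fun θ => by positivity) B hB0
          (fun θ => hB t ht (phi t - s - r * Real.cos θ))
        have h2 := final_sq (phi t - s) r δ M J hδ hJ0 h1
        have e1 : r - (phi t - s) = (r - phi t) + s := by ring
        have e2 : r + (phi t - s) = (r + phi t) - s := by ring
        rw [e1, e2] at h2
        exact h2
    _ = ENNReal.ofReal (M ^ 2) * (3 * ENNReal.ofReal (∫ x, f x)) := by
        rw [lintegral_const_mul _ (by fun_prop), lintegral_add_left (by fun_prop),
          lintegral_add_left (by fun_prop),
          lintegral_sub_left_eq_self (fun x => ENNReal.ofReal (f x)),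
          lintegral_sub_left_eq_self (fun x => ENNReal.ofReal (f x)),
          lintegral_add_left_eq_self (fun x => ENNReal.ofReal (f x)), hfin]
        ring
    _ = ENNReal.ofReal (M ^ 2 * (3 * ∫ x, f x)) := by
        rw [ENNReal.ofReal_mul (by positivity), ENNReal.ofReal_mul (by norm_num)]
        simp
    _ ≤ _ := ENNReal.ofReal_le_ofReal (by linarith)
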